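/- Let B0 be an [n,t] linear code over a field F and let C be an [n,k] linear code over F with 1 ≤ k ≤ n − t, such that (a) B0 is a subspace of C^⊥, and (b) every subset S of {1,…,n} with |S| = k that is a k-core of B0 is also a k-core of C^⊥. Then the minimum distance of C is exactly d_min(C) = n + 1 − g_k(B0), where g_k(B0) is the k-th gap of B0. -/

import Mathlib

open Classical in
/-- The support of a vector: the set of coordinates where it is nonzero. -/
noncomputable def vsupp {F : Type*} [Field F] {n : ℕ} (v : Fin n → F) : Finset (Fin n) :=
  Finset.univ.filter (fun i => v i ≠ 0)

open Classical in
/-- The support of a subspace: the union of the supports of its vectors. -/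
noncomputable def codeSupp {F : Type*} [Field F] {n : ℕ}
    (D : Submodule F (Fin n → F)) : Finset (Fin n) :=
  Finset.univ.filter (fun i => ∃ v ∈ D, v i ≠ 0)

/-- The dual code w.r.t. the standard bilinear form `⟨x,y⟩ = ∑ x i * y i`. -/
def dualCode {F : Type*} [Field F] {n : ℕ} (C : Submodule F (Fin n → F)) :
    Submodule F (Fin n → F) where
  carrier := {w | ∀ v ∈ C, ∑ i, v i * w i = 0}
  zero_mem' := by intro v _; simp
  add_mem' := by
    intro a b ha hb v hv
    have h : ∑ i, v i * (a + b) i = (∑ i, v i * a i) + ∑ i, v i * b i := by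
      simp [mul_add, Finset.sum_add_distrib]
    rw [h, ha v hv, hb v hv, add_zero]
  smul_mem' := by
    intro c a ha v hv
    have h : ∑ i, v i * (c • a) i = c * ∑ i, v i * a i := by
      simp [Finset.mul_sum, mul_left_comm]
    rw [h, ha v hv, mul_zero]

/-- The `i`-th generalized Hamming weight (1-indexed): the minimum support cardinality
of an `i`-dimensional subspace. -/
noncomputable def ghw {F : Type*} [Field F] {n : ℕ} (C : Submodule F (Fin n → F)) (i : ℕ) : ℕ :=
  sInf {s | ∃ D : Submodule F (Fin n → F), D ≤ C ∧ Module.finrank F D = i ∧ (codeSupp D).card = s}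

/-- The set of gaps of a code: elements of `{1,…,n}` that are not generalized Hamming weights. -/
noncomputable def gapSet {F : Type*} [Field F] {n : ℕ} (C : Submodule F (Fin n → F)) : Finset ℕ :=
  (Finset.Icc 1 n) \ ((Finset.Icc 1 (Module.finrank F C)).image (ghw C))

/-- The `i`-th gap of a code (1-indexed), via the increasing enumeration of the gap set. -/
noncomputable def gapNum {F : Type*} [Field F] {n : ℕ} (C : Submodule F (Fin n → F)) (i : ℕ) : ℕ :=
  ((gapSet C).sort (· ≤ ·)).getD (i - 1) 0

/-- The minimum distance of a code: the minimum Hamming weight of a nonzero codeword. -/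
noncomputable def dmin {F : Type*} [Field F] {n : ℕ} (C : Submodule F (Fin n → F)) : ℕ :=
  sInf {w | ∃ v ∈ C, v ≠ 0 ∧ (vsupp v).card = w}

/-- `S` is an `ℓ`-core (`ℓ = S.card`) of `B` if no nonzero codeword of `B`
has its support contained in `S`. -/
def isCore {F : Type*} [Field F] {n : ℕ} (B : Submodule F (Fin n → F)) (S : Finset (Fin n)) : Prop :=
  ∀ v ∈ B, v ≠ 0 → ¬ (vsupp v ⊆ S)

/-- The subspace of the dual code spanned by all its codewords of Hamming weight `≤ r+1`. -/
noncomputable def lowWtSpan {F : Type*} [Field F] {n : ℕ}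
    (C : Submodule F (Fin n → F)) (r : ℕ) : Submodule F (Fin n → F) :=
  Submodule.span F {c | c ∈ dualCode C ∧ (vsupp c).card ≤ r + 1}

/-- `A_i`: the set of local parities covering coordinate `i`, i.e. dual codewords of
Hamming weight at most `r+1` whose support contains `i`. -/
def coveringParities {F : Type*} [Field F] {n : ℕ}
    (C : Submodule F (Fin n → F)) (r : ℕ) (i : Fin n) : Set (Fin n → F) :=
  {c | c ∈ dualCode C ∧ (vsupp c).card ≤ r + 1 ∧ c i ≠ 0}

/-- `C` is locally 2-reconstructible with locality `r`: every `A_i` is nonempty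
and `A_i ≠ A_j` for `i ≠ j`. -/
def Locally2Recon {F : Type*} [Field F] {n : ℕ}
    (C : Submodule F (Fin n → F)) (r : ℕ) : Prop :=
  (∀ i : Fin n, (coveringParities C r i).Nonempty) ∧
  (∀ i j : Fin n, i ≠ j → coveringParities C r i ≠ coveringParities C r j)

open Module Pi

section CodeLemmas

variable {F : Type*} [Field F] {n : ℕ}

lemma vsupp_subset_iff (v : Fin n → F) (S : Finset (Fin n)) :
    vsupp v ⊆ S ↔ v ∈ spanSubset F (S : Set (Fin n)) := by
  simp only [mem_spanSubset_iff, vsupp, Finset.subset_iff, Finset.mem_filter, Finset.mem_univ,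
    true_and, Finset.mem_coe]
  exact forall_congr' fun i => not_imp_comm

lemma codeSupp_subset_iff (D : Submodule F (Fin n → F)) (S : Finset (Fin n)) :
    codeSupp D ⊆ S ↔ D ≤ spanSubset F (S : Set (Fin n)) := by
  simp only [SetLike.le_def, mem_spanSubset_iff, codeSupp, Finset.mem_filter,
    Finset.mem_univ, true_and, Finset.mem_coe]
  exact ⟨fun h v hv i hi => by_contra fun hvi => hi (h ⟨v, hv, hvi⟩),
    fun h i ⟨v, hv, hvi⟩ => by_contra fun hi => hvi (h hv i hi)⟩

/-- The subcode of `B` formed by the codewords supported in `S`. -/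
noncomputable def subcodeOn (B : Submodule F (Fin n → F)) (S : Finset (Fin n)) :
    Submodule F (Fin n → F) :=
  B ⊓ spanSubset F (S : Set (Fin n))

lemma mem_subcodeOn {B : Submodule F (Fin n → F)} {S : Finset (Fin n)} {v : Fin n → F} :
    v ∈ subcodeOn B S ↔ v ∈ B ∧ ∀ i ∉ S, v i = 0 := by
  simp [subcodeOn, mem_spanSubset_iff]

lemma isCore_iff_subcodeOn_eq_bot (B : Submodule F (Fin n → F)) (S : Finset (Fin n)) :
    isCore B S ↔ subcodeOn B S = ⊥ := by
  simp only [Submodule.eq_bot_iff, isCore, vsupp_subset_iff, subcodeOn, Submodule.mem_inf]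
  exact ⟨fun h v hv => by_contra fun h0 => h v hv.1 h0 hv.2, fun h v hv h0 hs => h0 (h v ⟨hv, hs⟩)⟩

lemma subcodeOn_mono_right (B : Submodule F (Fin n → F)) {S T : Finset (Fin n)} (h : S ⊆ T) :
    subcodeOn B S ≤ subcodeOn B T :=
  fun _ hv => mem_subcodeOn.2
    ⟨(mem_subcodeOn.1 hv).1, fun i hi => (mem_subcodeOn.1 hv).2 i fun hS => hi (h hS)⟩

lemma isCore.subset {B : Submodule F (Fin n → F)} {S T : Finset (Fin n)} (hT : isCore B T)
    (h : S ⊆ T) : isCore B S :=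
  fun v hv h0 hs => hT v hv h0 (hs.trans h)

lemma finrank_subcodeOn_le_erase (B : Submodule F (Fin n → F)) (S : Finset (Fin n)) (i : Fin n) :
    finrank F (subcodeOn B S) ≤ finrank F (subcodeOn B (S.erase i)) + 1 := by
  let f : subcodeOn B S →ₗ[F] F := (LinearMap.proj i).comp (subcodeOn B S).subtype
  have hker : finrank F (LinearMap.ker f) ≤ finrank F (subcodeOn B (S.erase i)) := by
    rw [← Submodule.finrank_map_subtype_eq]
    refine Submodule.finrank_mono ?_
    rintro _ ⟨⟨v, hv⟩, hf, rfl⟩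
    have hvi : v i = 0 := hf
    rw [mem_subcodeOn] at hv
    refine mem_subcodeOn.2 ⟨hv.1, fun j hj => ?_⟩
    by_cases hji : j = i
    · simpa [hji] using hvi
    · exact hv.2 j fun hjS => hj (Finset.mem_erase.2 ⟨hji, hjS⟩)
  have hrange : finrank F (LinearMap.range f) ≤ 1 := by
    simpa using Submodule.finrank_le (LinearMap.range f)
  have := f.finrank_range_add_finrank_ker
  omega

/-- Every set contains a core whose size is at least the corank of the subcode on that set. -/
lemma exists_isCore_subset (B : Submodule F (Fin n → F)) (S : Finset (Fin n)) :
    ∃ T ⊆ S, isCore B T ∧ S.card ≤ T.card + finrank F (subcodeOn B S) := by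
  induction S using Finset.strongInduction with
  | H S ih =>
    by_cases hS : isCore B S
    · exact ⟨S, subset_rfl, hS, by omega⟩
    · obtain ⟨v, hv, h0, hvS⟩ : ∃ v ∈ B, v ≠ 0 ∧ vsupp v ⊆ S := by
        simpa [isCore] using hS
      obtain ⟨i, hi⟩ := Function.ne_iff.1 h0
      have hiS : i ∈ S := hvS (by simpa [vsupp] using hi)
      obtain ⟨T, hTS, hT, hcard⟩ := ih _ (Finset.erase_ssubset hiS)
      refine ⟨T, hTS.trans (Finset.erase_subset _ _), hT, ?_⟩
      have hlt : finrank F (subcodeOn B (S.erase i)) < finrank F (subcodeOn B S) := by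
        refine Submodule.finrank_lt_finrank_of_lt
          (lt_of_le_of_ne (subcodeOn_mono_right B (Finset.erase_subset _ _)) fun heq => hi ?_)
        have hmem : v ∈ subcodeOn B S := ⟨hv, (vsupp_subset_iff v S).1 hvS⟩
        rw [← heq, mem_subcodeOn] at hmem
        exact hmem.2 i (Finset.notMem_erase i S)
      have := Finset.card_erase_add_one hiS
      omega

lemma dualCode_eq_orthogonal (C : Submodule F (Fin n → F)) :
    dualCode C = LinearMap.BilinForm.orthogonal (dotProductBilin F F) C := rfl

lemma finrank_dualCode (C : Submodule F (Fin n → F)) :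
    finrank F C + finrank F (dualCode C) = n := by
  have hker : LinearMap.ker (dotProductBilin F F : (Fin n → F) →ₗ[F] (Fin n → F) →ₗ[F] F) = ⊥ := by
    refine (Submodule.eq_bot_iff _).2 fun v hv => dotProduct_eq_zero v fun w => ?_
    exact LinearMap.congr_fun hv w
  have h := LinearMap.BilinForm.finrank_add_finrank_orthogonal' (B := dotProductBilin F F) C
  rw [hker, inf_bot_eq, finrank_bot, ← dualCode_eq_orthogonal] at h
  simpa using h

lemma le_dualCode_dualCode (C : Submodule F (Fin n → F)) : C ≤ dualCode (dualCode C) :=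
  fun v hv w hw => by simpa [mul_comm] using hw v hv

lemma dualCode_dualCode (C : Submodule F (Fin n → F)) : dualCode (dualCode C) = C := by
  refine (Submodule.eq_of_le_of_finrank_le (le_dualCode_dualCode C) ?_).symm
  have := finrank_dualCode C
  have := finrank_dualCode (dualCode C)
  omega

lemma dualCode_sup (A B : Submodule F (Fin n → F)) :
    dualCode (A ⊔ B) = dualCode A ⊓ dualCode B := by
  ext w
  refine ⟨fun h => ⟨fun v hv => h v (Submodule.mem_sup_left hv),
    fun v hv => h v (Submodule.mem_sup_right hv)⟩, fun h v hv => ?_⟩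
  obtain ⟨a, ha, b, hb, rfl⟩ := Submodule.mem_sup.1 hv
  simp [add_mul, Finset.sum_add_distrib, h.1 a ha, h.2 b hb]

lemma dualCode_spanSubset (S : Finset (Fin n)) :
    dualCode (spanSubset F (S : Set (Fin n))) = spanSubset F ((Sᶜ : Finset (Fin n)) : Set _) := by
  ext w
  simp only [mem_spanSubset_iff, Finset.mem_coe, Finset.mem_compl, not_not]
  refine ⟨fun h i hi => ?_, fun h v hv => Finset.sum_eq_zero fun i _ => ?_⟩
  · have := h (Pi.single i 1) (mem_spanSubset_iff.2 fun j hj => Pi.single_eq_of_ne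
      (fun hji => hj (by simpa [hji] using hi)) _)
    simpa [Pi.single_apply] using this
  · by_cases hi : i ∈ S
    · simp [h i hi]
    · simp [mem_spanSubset_iff.1 hv i hi]

/-- Shortening `C` off `S` and shortening its dual to `S` have complementary dimensions. -/
lemma finrank_subcodeOn_compl (C : Submodule F (Fin n → F)) (S : Finset (Fin n)) :
    finrank F (subcodeOn C Sᶜ) + S.card = finrank F C + finrank F (subcodeOn (dualCode C) S) := by
  have h1 := finrank_dualCode (dualCode C ⊔ spanSubset F (S : Set (Fin n)))
  rw [dualCode_sup, dualCode_dualCode, dualCode_spanSubset] at h1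
  have h2 := Submodule.finrank_sup_add_finrank_inf_eq (dualCode C) (spanSubset F (S : Set (Fin n)))
  have h3 := finrank_dualCode C
  rw [Pi.dim_spanSubset, Set.ncard_coe_finset] at h2
  change finrank F (C ⊓ _ : Submodule F (Fin n → F)) + _ =
    _ + finrank F (dualCode C ⊓ _ : Submodule F (Fin n → F))
  omega

lemma exists_le_finrank_eq {V : Type*} [AddCommGroup V] [Module F V] {B : Submodule F V} {i : ℕ}
    (hi : i ≤ finrank F B) : ∃ D ≤ B, finrank F D = i := by
  obtain ⟨f, hf⟩ := exists_linearIndependent_of_le_finrank hi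
  refine ⟨(Submodule.span F (Set.range f)).map B.subtype, Submodule.map_subtype_le _ _, ?_⟩
  rw [Submodule.finrank_map_subtype_eq, finrank_span_eq_card hf, Fintype.card_fin]

lemma exists_subcodeOn_ghw (B : Submodule F (Fin n → F)) {i : ℕ} (hi : i ≤ finrank F B) :
    ∃ S : Finset (Fin n), S.card = ghw B i ∧ i ≤ finrank F (subcodeOn B S) := by
  obtain ⟨D₀, hD₀, hr₀⟩ := exists_le_finrank_eq hi
  obtain ⟨D, hDB, hD, hcard⟩ := Nat.sInf_mem
    (s := {s | ∃ D : Submodule F (Fin n → F), D ≤ B ∧ finrank F D = i ∧ (codeSupp D).card = s})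
    ⟨_, D₀, hD₀, hr₀, rfl⟩
  exact ⟨codeSupp D, hcard, hD ▸ Submodule.finrank_mono
    (le_inf hDB ((codeSupp_subset_iff D _).1 subset_rfl))⟩

lemma ghw_le_card (B : Submodule F (Fin n → F)) {i : ℕ} {S : Finset (Fin n)}
    (hi : i ≤ finrank F (subcodeOn B S)) : ghw B i ≤ S.card := by
  obtain ⟨D, hD, hr⟩ := exists_le_finrank_eq hi
  have hle : ghw B i ≤ (codeSupp D).card := Nat.sInf_le ⟨D, hD.trans inf_le_left, hr, rfl⟩
  exact hle.trans
    (Finset.card_le_card ((codeSupp_subset_iff D S).2 (hD.trans inf_le_right)))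

lemma ghw_lt_succ (B : Submodule F (Fin n → F)) {i : ℕ} (hi : i + 1 ≤ finrank F B) :
    ghw B i < ghw B (i + 1) := by
  obtain ⟨S, hS, hr⟩ := exists_subcodeOn_ghw B hi
  obtain ⟨j, hj⟩ : S.Nonempty := by
    rw [Finset.nonempty_iff_ne_empty]
    rintro rfl
    have : subcodeOn B ∅ = ⊥ := (Submodule.eq_bot_iff _).2 fun v hv =>
      funext fun i => (mem_subcodeOn.1 hv).2 i (Finset.notMem_empty i)
    rw [this, finrank_bot] at hr
    omega
  have h1 := finrank_subcodeOn_le_erase B S j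
  have h2 := ghw_le_card B (i := i) (S := S.erase j) (by omega)
  have h3 := Finset.card_erase_add_one hj
  omega

lemma ghw_strictMonoOn (B : Submodule F (Fin n → F)) :
    StrictMonoOn (ghw B) (Set.Iic (finrank F B)) :=
  strictMonoOn_of_lt_add_one Set.ordConnected_Iic fun _ _ _ h => ghw_lt_succ B h

lemma one_le_ghw (B : Submodule F (Fin n → F)) {i : ℕ} (hi : 1 ≤ i) (hi' : i ≤ finrank F B) :
    1 ≤ ghw B i :=
  (Nat.zero_le _).trans_lt
    (ghw_strictMonoOn B (show 0 ∈ Set.Iic (finrank F B) from Nat.zero_le _) hi' hi)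

lemma exists_card_eq_of_card_image_ghw (B : Submodule F (Fin n → F)) {s m : ℕ} (hs : s ≤ n)
    (hm : m ≤ (((Finset.Icc 1 (finrank F B)).image (ghw B)).filter (· ≤ s)).card) :
    ∃ S : Finset (Fin n), S.card = s ∧ m ≤ finrank F (subcodeOn B S) := by
  obtain ⟨S, hS, hm⟩ : ∃ S : Finset (Fin n), S.card ≤ s ∧ m ≤ finrank F (subcodeOn B S) := by
    rcases Nat.eq_zero_or_pos m with rfl | hpos
    · exact ⟨∅, by simp, Nat.zero_le _⟩
    · obtain ⟨i, hi, his, hmi⟩ : ∃ i ≤ finrank F B, ghw B i ≤ s ∧ m ≤ i := by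
        by_contra! hcon
        have hsub : ((Finset.Icc 1 (finrank F B)).image (ghw B)).filter (· ≤ s) ⊆
            (Finset.Icc 1 (m - 1)).image (ghw B) := by
          intro x hx
          simp only [Finset.mem_filter, Finset.mem_image, Finset.mem_Icc] at hx ⊢
          obtain ⟨⟨i, hi, rfl⟩, hx⟩ := hx
          exact ⟨i, ⟨hi.1, by have := hcon i hi.2 hx; omega⟩, rfl⟩
        have := (Finset.card_le_card hsub).trans Finset.card_image_le
        simp only [Nat.card_Icc] at this
        omega
      obtain ⟨S, hS, hr⟩ := exists_subcodeOn_ghw B hi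
      exact ⟨S, hS ▸ his, hmi.trans hr⟩
  obtain ⟨T, hST, -, hT⟩ := Finset.exists_subsuperset_card_eq (Finset.subset_univ S) hS (by simpa)
  exact ⟨T, hT, hm.trans (Submodule.finrank_mono (subcodeOn_mono_right B hST))⟩

lemma finrank_subcodeOn_le_card_image_ghw (B : Submodule F (Fin n → F)) (S : Finset (Fin n)) :
    finrank F (subcodeOn B S) ≤
      (((Finset.Icc 1 (finrank F B)).image (ghw B)).filter (· ≤ S.card)).card := by
  have hle : finrank F (subcodeOn B S) ≤ finrank F B := Submodule.finrank_mono inf_le_left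
  have hinj : Set.InjOn (ghw B) (Finset.Icc 1 (finrank F (subcodeOn B S))) :=
    (ghw_strictMonoOn B).injOn.mono fun i hi => (Finset.mem_Icc.1 hi).2.trans hle
  have hcard := Finset.card_image_of_injOn hinj
  rw [Nat.card_Icc, Nat.add_sub_cancel] at hcard
  rw [← hcard]
  refine Finset.card_le_card fun x hx => ?_
  simp only [Finset.mem_filter, Finset.mem_image, Finset.mem_Icc] at hx ⊢
  obtain ⟨i, hi, rfl⟩ := hx
  exact ⟨⟨i, ⟨hi.1, hi.2.trans hle⟩, rfl⟩, ghw_le_card B hi.2⟩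

lemma card_filter_gapSet (B : Submodule F (Fin n → F)) {s : ℕ} (hs : s ≤ n) :
    ((gapSet B).filter (· ≤ s)).card +
      (((Finset.Icc 1 (finrank F B)).image (ghw B)).filter (· ≤ s)).card = s := by
  have hunion : (gapSet B).filter (· ≤ s) ∪
      ((Finset.Icc 1 (finrank F B)).image (ghw B)).filter (· ≤ s) = Finset.Icc 1 s := by
    ext x
    have hpos : x ∈ (Finset.Icc 1 (finrank F B)).image (ghw B) → 1 ≤ x := by
      simp only [Finset.mem_image, Finset.mem_Icc]
      rintro ⟨i, hi, rfl⟩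
      exact one_le_ghw B hi.1 hi.2
    simp only [gapSet, Finset.mem_union, Finset.mem_filter, Finset.mem_sdiff, Finset.mem_Icc]
    by_cases hx : x ∈ (Finset.Icc 1 (finrank F B)).image (ghw B)
    · simp [hx, hpos hx]
    · simp only [hx, not_false_eq_true, and_true, false_and, or_false]
      omega
  rw [← Finset.card_union_of_disjoint, hunion, Nat.card_Icc, Nat.add_sub_cancel]
  exact Finset.disjoint_filter_filter Finset.sdiff_disjoint

lemma le_card_gapSet (B : Submodule F (Fin n → F)) : n - finrank F B ≤ (gapSet B).card := by
  have h1 := Finset.le_card_sdiff ((Finset.Icc 1 (finrank F B)).image (ghw B)) (Finset.Icc 1 n)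
  have h2 := Finset.card_image_le (s := Finset.Icc 1 (finrank F B)) (f := ghw B)
  simp only [Nat.card_Icc, Nat.add_sub_cancel] at h1 h2
  unfold gapSet
  omega

lemma card_filter_lt_orderEmbOfFin (A : Finset ℕ) (i : Fin A.card) :
    (A.filter (· < A.orderEmbOfFin rfl i)).card = i := by
  have : A.filter (· < A.orderEmbOfFin rfl i) =
      (Finset.Iio i).map (A.orderEmbOfFin rfl).toEmbedding := by
    ext x
    simp only [Finset.mem_filter, Finset.mem_map, Finset.mem_Iio, RelEmbedding.coe_toEmbedding]
    constructor
    · rintro ⟨hx, hlt⟩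
      obtain ⟨j, rfl⟩ : x ∈ Set.range (A.orderEmbOfFin rfl) := by simpa using hx
      exact ⟨j, by simpa using hlt, rfl⟩
    · rintro ⟨j, hj, rfl⟩
      exact ⟨Finset.orderEmbOfFin_mem _ _ _, by simpa using hj⟩
  rw [this, Finset.card_map, Fin.card_Iio]

lemma gapNum_spec (B : Submodule F (Fin n → F)) {k : ℕ} (hk : 1 ≤ k)
    (hkn : k ≤ n - finrank F B) :
    gapNum B k ∈ gapSet B ∧ ((gapSet B).filter (· < gapNum B k)).card = k - 1 := by
  have hlt : k - 1 < (gapSet B).card := by have := le_card_gapSet B; omega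
  have heq : gapNum B k = (gapSet B).orderEmbOfFin rfl ⟨k - 1, hlt⟩ := by
    rw [Finset.orderEmbOfFin_apply, gapNum, List.getD_eq_getElem]
    rfl
  rw [heq]
  exact ⟨Finset.orderEmbOfFin_mem _ _ _, card_filter_lt_orderEmbOfFin _ _⟩

end CodeLemmas

/-- Theorem 1 of the paper: if `B0 ≤ C^⊥` and every `k`-core of `B0`
is a `k`-core of `C^⊥`, then `d_min(C) = n + 1 - g_k(B0)`. -/
theorem stmt3 {F : Type*} [Field F] {n t k : ℕ}
    (B0 C : Submodule F (Fin n → F))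
    (ht : Module.finrank F B0 = t) (hC : Module.finrank F C = k)
    (hk1 : 1 ≤ k) (hkt : k ≤ n - t)
    (hsub : B0 ≤ dualCode C)
    (hcore : ∀ S : Finset (Fin n), S.card = k → isCore B0 S → isCore (dualCode C) S) :
    dmin C = n + 1 - gapNum B0 k := by
  obtain ⟨hgap, hgapcard⟩ := gapNum_spec B0 hk1 (ht ▸ hkt)
  set g := gapNum B0 k
  have hg : 1 ≤ g ∧ g ≤ n := by simpa using (Finset.mem_sdiff.1 hgap).1
  have hlower : ∀ v ∈ C, v ≠ 0 → n + 1 - g ≤ (vsupp v).card := by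
    intro v hv h0
    by_contra! hlt
    have hScard := Finset.card_add_card_compl (vsupp v)
    rw [Fintype.card_fin] at hScard
    have hgaps : k ≤ ((gapSet B0).filter (· ≤ (vsupp v)ᶜ.card)).card := by
      have hss : (gapSet B0).filter (· < g) ⊂ (gapSet B0).filter (· ≤ (vsupp v)ᶜ.card) := by
        refine (Finset.ssubset_iff_of_subset fun x hx => ?_).2 ⟨g, ?_, by simp⟩
        · simp only [Finset.mem_filter] at hx ⊢
          exact ⟨hx.1, by omega⟩
        · exact Finset.mem_filter.2 ⟨hgap, by omega⟩
      have := Finset.card_lt_card hss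
      omega
    have hcount := card_filter_gapSet B0 (s := (vsupp v)ᶜ.card) (by omega)
    have hdim := finrank_subcodeOn_le_card_image_ghw B0 (vsupp v)ᶜ
    obtain ⟨T, hTS, hT, hTcard⟩ := exists_isCore_subset B0 (vsupp v)ᶜ
    obtain ⟨I, hIT, hI⟩ := Finset.exists_subset_card_eq (show k ≤ T.card by omega)
    have hIcore := (isCore_iff_subcodeOn_eq_bot _ _).1 (hcore I hI (hT.subset hIT))
    have hshort := finrank_subcodeOn_compl C I
    rw [hIcore, finrank_bot, hI, hC, add_zero, Nat.add_eq_right, Submodule.finrank_eq_zero]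
      at hshort
    have hmem : v ∈ subcodeOn C Iᶜ := ⟨hv, (vsupp_subset_iff v _).1
      (Finset.subset_compl_comm.1 (hIT.trans hTS))⟩
    rw [hshort] at hmem
    exact h0 hmem
  obtain ⟨v, hv, h0, hle⟩ : ∃ v ∈ C, v ≠ 0 ∧ (vsupp v).card ≤ n + 1 - g := by
    have hcount := card_filter_gapSet B0 (s := g - 1) (by omega)
    have hfilter : (gapSet B0).filter (· ≤ g - 1) = (gapSet B0).filter (· < g) :=
      Finset.filter_congr fun x _ => by omega
    rw [hfilter, hgapcard] at hcount
    obtain ⟨S, hS, hdim⟩ := exists_card_eq_of_card_image_ghw B0 (by omega : g - 1 ≤ n) le_rfl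
    have hmono : finrank F (subcodeOn B0 S) ≤ finrank F (subcodeOn (dualCode C) S) :=
      Submodule.finrank_mono (inf_le_inf_right _ hsub)
    have hshort := finrank_subcodeOn_compl C S
    have hne : subcodeOn C Sᶜ ≠ ⊥ := by
      intro hbot
      rw [hbot, finrank_bot] at hshort
      omega
    obtain ⟨v, hv, h0⟩ := Submodule.exists_mem_ne_zero_of_ne_bot hne
    refine ⟨v, hv.1, h0, (Finset.card_le_card ((vsupp_subset_iff v _).2 hv.2)).trans ?_⟩
    rw [Finset.card_compl, Fintype.card_fin]
    omega
  have hmin : dmin C ≤ (vsupp v).card := Nat.sInf_le ⟨v, hv, h0, rfl⟩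
  refine le_antisymm (hmin.trans hle) (le_csInf ⟨_, v, hv, h0, rfl⟩ ?_)
  rintro _ ⟨w, hw, hw0, rfl⟩
  exact hlower w hw hw0
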